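/- arXiv:1302.2486 — 2 statements merged into one kernel-verified Lean document; each statement's English description precedes it below -/
import Mathlib

section
/- Let s = s_1⋯s_N be a finite binary word beginning with 0, and suppose for some ℓ ∈ {1,…,N−1} the cyclic permutation t = s_{ℓ+1}⋯s_N s_1⋯s_ℓ begins with 1 and the pair (s,t) is extremal. For (n_1,n_2,…) ∈ ℕ^ℕ put w(n_1,n_2,…) = s^{n_1} s_1⋯s_ℓ s^{n_2} s_1⋯s_ℓ ⋯, and for n ∈ ℕ let W_n be the closure in Σ of {σʲ(w(n_1,n_2,…)) : j ≥ 0 and n_i ∈ {n,n+1} for all i}. Then for every sequence u ∈ Σ with s t^∞ ≺ u ≺ t s^∞ there exists n ∈ ℕ such that W_n ∩ {v ∈ Σ : s^∞ ≺ v ≺ u} = ∅. -/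
noncomputable section

/-- The doubling map. -/
def Dbl (x : ℝ) : ℝ := if x ≤ 1/2 then 2*x else 2*x - 1

/-- Survivor set `𝒥(a,b)`. -/
def J (a b : ℝ) : Set ℝ := {x ∈ Set.Icc (0:ℝ) 1 | ∀ n : ℕ, Dbl^[n] x ∉ Set.Ioo a b}

/-- The shift on binary sequences. -/
def shft (x : ℕ → Bool) : ℕ → Bool := fun n => x (n+1)

/-- Binary expansion value. -/
def piMap (w : ℕ → Bool) : ℝ := ∑' n : ℕ, (if w n then (1:ℝ) else 0) / 2 ^ (n+1)

/-- Strict lexicographic order on binary sequences. -/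
def seqLt (u v : ℕ → Bool) : Prop := ∃ n, (∀ i < n, u i = v i) ∧ u n < v n

def seqLe (u v : ℕ → Bool) : Prop := seqLt u v ∨ u = v

/-- Periodic sequence `w^∞` associated with a finite word. -/
def per (w : List Bool) : ℕ → Bool := fun n => w.getD (n % w.length) false

/-- Concatenation of a finite word and an infinite sequence. -/
def cat (w : List Bool) (x : ℕ → Bool) : ℕ → Bool :=
  fun n => if n < w.length then w.getD n false else x (n - w.length)

/-- A finite word is balanced. -/
def BalancedWord (l : List Bool) : Prop :=
  ∀ u v : List Bool, u <:+: l → v <:+: l → u.length = v.length →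
    (u.count true : ℤ) - (v.count true : ℤ) ≤ 1

/-- A finite word is cyclically balanced. -/
def CycBalanced (w : List Bool) : Prop := BalancedWord (w ++ w)

def OmegaSet (r : ℚ) (b : Bool) : Set (List Bool) :=
  {w | w.length = r.den ∧ w.count true = r.num.toNat ∧ CycBalanced w ∧ w.head? = some b}

/-- `w` is the lexicographically largest cyclically balanced word of length `q`
with `p` ones beginning with 0, where `r = p/q` in lowest terms. -/
def IsOmegaMinus (r : ℚ) (w : List Bool) : Prop :=
  w ∈ OmegaSet r false ∧ ∀ v ∈ OmegaSet r false, v = w ∨ List.Lex (· < ·) v w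

/-- `w` is the lexicographically smallest cyclically balanced word of length `q`
with `p` ones beginning with 1. -/
def IsOmegaPlus (r : ℚ) (w : List Bool) : Prop :=
  w ∈ OmegaSet r true ∧ ∀ v ∈ OmegaSet r true, v = w ∨ List.Lex (· < ·) w v

open Classical in
def omegaMinus (r : ℚ) : List Bool :=
  if h : ∃ w, IsOmegaMinus r w then h.choose else []

open Classical in
def omegaPlus (r : ℚ) : List Bool :=
  if h : ∃ w, IsOmegaPlus r w then h.choose else []

/-- The substitution `ρ_r` applied to a word. -/
def substR (r : ℚ) (w : List Bool) : List Bool :=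
  (w.map (fun b => if b then omegaPlus r else omegaMinus r)).flatten

/-- `s_n = ρ_{r_1}∘⋯∘ρ_{r_n}(0)`. -/
def sWord : List ℚ → List Bool
  | [] => [false]
  | r :: rs => substR r (sWord rs)

/-- `t_n = ρ_{r_1}∘⋯∘ρ_{r_n}(1)`. -/
def tWord : List ℚ → List Bool
  | [] => [true]
  | r :: rs => substR r (tWord rs)

/-- `Δ(r_1,…,r_n) = [π(s_n^∞), π(s_n t_n^∞)]`. -/
def DeltaI (rs : List ℚ) : Set ℝ :=
  Set.Icc (piMap (per (sWord rs))) (piMap (cat (sWord rs) (per (tWord rs))))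

/-- `Δ̃(r_1,…,r_n) = [π(s_n t_n s_n^∞), π(s_n t_n^∞)]`. -/
def DeltaTilde (rs : List ℚ) : Set ℝ :=
  Set.Icc (piMap (cat (sWord rs) (cat (tWord rs) (per (sWord rs)))))
    (piMap (cat (sWord rs) (per (tWord rs))))

/-- The exceptional set `𝒮`. -/
def Scal : Set ℝ :=
  Set.Ioo (1/4 : ℝ) (1/2) \ ⋃ r ∈ {r : ℚ | 0 < r ∧ r < 1}, DeltaI [r]

/-- `φ(a)`. -/
def phi (a : ℝ) : ℝ := sSup {b | b ∈ Set.Ioo a 1 ∧ J a b ≠ ({0, 1} : Set ℝ)}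

/-- `χ(a)`. -/
def chi (a : ℝ) : ℝ := sSup {b | b ∈ Set.Ioo a 1 ∧ ¬ (J a b).Countable}

/-- `s_n` built from the first `m` entries of an infinite sequence of rationals. -/
def sWordN (r : ℕ → ℚ) (m : ℕ) : List Bool := sWord (List.ofFn fun i : Fin m => r i)

def tWordN (r : ℕ → ℚ) (m : ℕ) : List Bool := tWord (List.ofFn fun i : Fin m => r i)

/-- `𝔰(𝐫)`, the coordinatewise limit of `ρ_{r_1}⋯ρ_{r_n}(0)`. -/
def sLim (r : ℕ → ℚ) : ℕ → Bool := fun k => (sWordN r (k+1)).getD k false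

/-- `𝔱(𝐫)`. -/
def tLim (r : ℕ → ℚ) : ℕ → Bool := fun k => (tWordN r (k+1)).getD k false

/-- A pair `(s,t)` of finite binary words (s beginning with 0, t with 1) is extremal. -/
def Extremal (s t : List Bool) : Prop :=
  s.head? = some false ∧ t.head? = some true ∧
  (∀ k, 1 ≤ k → k ≤ s.length - 1 →
    ¬ (seqLe (per s) (shft^[k] (per s)) ∧ seqLt (shft^[k] (per s)) (per t))) ∧
  (∀ l, 1 ≤ l → l ≤ t.length - 1 →
    ¬ (seqLt (per s) (shft^[l] (per t)) ∧ seqLe (shft^[l] (per t)) (per t)))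

/-- Finite prefix `f 0 ++ ⋯ ++ f (m-1)` of an infinite concatenation. -/
def catInfPrefix (f : ℕ → List Bool) : ℕ → List Bool
  | 0 => []
  | m + 1 => catInfPrefix f m ++ f m

/-- Infinite concatenation `f 0 ++ f 1 ++ ⋯` of a sequence of nonempty words. -/
def catInf (f : ℕ → List Bool) : ℕ → Bool := fun n => (catInfPrefix f (n+1)).getD n false

lemma shft_iter (k : ℕ) (x : ℕ → Bool) (i : ℕ) : (shft^[k] x) i = x (i + k) := by
  induction k generalizing x i with
  | zero => rfl
  | succ k ih =>
    rw [Function.iterate_succ_apply, ih]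
    simp only [shft]
    congr 1

lemma seqLt_trans {a b c : ℕ → Bool} (h1 : seqLt a b) (h2 : seqLt b c) : seqLt a c := by
  obtain ⟨n, hn, hn'⟩ := h1
  obtain ⟨m, hm, hm'⟩ := h2
  rcases lt_trichotomy n m with h | h | h
  · exact ⟨n, fun i hi => (hn i hi).trans (hm i (hi.trans h)), by rw [← hm n h]; exact hn'⟩
  · subst h
    exact ⟨n, fun i hi => (hn i hi).trans (hm i hi), hn'.trans hm'⟩
  · exact ⟨m, fun i hi => (hn i (hi.trans h)).trans (hm i hi), by rw [hn m h]; exact hm'⟩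

lemma seqLt_irrefl (a : ℕ → Bool) : ¬ seqLt a a := by
  rintro ⟨n, _, h⟩
  exact lt_irrefl _ h

lemma seqLt_or_le (a b : ℕ → Bool) : seqLt a b ∨ seqLe b a := by
  by_cases h : ∃ n, a n ≠ b n
  · classical
    have h1 := Nat.find_spec h
    have h2 : ∀ i < Nat.find h, a i = b i := fun i hi => by
      have := Nat.find_min h hi
      simpa using this
    rcases lt_or_gt_of_ne h1 with h3 | h3
    · exact Or.inl ⟨_, h2, h3⟩
    · exact Or.inr (Or.inl ⟨_, fun i hi => (h2 i hi).symm, h3⟩)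
  · push Not at h
    exact Or.inr (Or.inr (funext h).symm)

lemma seqLt_of_lt_of_le {a b c : ℕ → Bool} (h1 : seqLt a b) (h2 : seqLe b c) : seqLt a c := by
  rcases h2 with h2 | h2
  · exact seqLt_trans h1 h2
  · exact h2 ▸ h1

/-- If `u < A` at position `p`, `A ≤ Q` and `v` agrees with `Q` up to `p`, then `u < v`. -/
lemma seqLt_agree {u A Q v : ℕ → Bool} {p : ℕ} (h1 : ∀ i < p, u i = A i) (h2 : u p < A p)
    (h3 : seqLe A Q) (h4 : ∀ i ≤ p, v i = Q i) : seqLt u v := by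
  rcases h3 with ⟨m, hm, hm'⟩ | rfl
  · rcases lt_or_ge p m with h | h
    · exact ⟨p, fun i hi => by rw [h4 i hi.le, h1 i hi, hm i (hi.trans h)],
        by rw [h4 p le_rfl, ← hm p h]; exact h2⟩
    · refine ⟨m, fun i hi => by rw [h4 i (by omega), h1 i (by omega), hm i hi], ?_⟩
      rw [h4 m h]
      rcases h.lt_or_eq with h | h
      · rw [h1 m h]; exact hm'
      · subst h; exact h2.trans hm'
  · exact ⟨p, fun i hi => by rw [h4 i hi.le, h1 i hi], by rw [h4 p le_rfl]; exact h2⟩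

lemma core (P T : ℕ → Bool) (N ℓ : ℕ) (hN : 1 ≤ N) (hper : ∀ i, P (i + N) = P i)
    (hT : ∀ i, T i = P (i + ℓ)) (P0 : P 0 = false) (T0 : T 0 = true)
    (E2 : ∀ l, 1 ≤ l → l ≤ N - 1 →
      ¬ (seqLt P (fun i => T (i + l)) ∧ seqLe (fun i => T (i + l)) T))
    (B : ℕ → Bool) (hB1 : ∀ i < N, B i = T i) (hB2 : ∀ i, B (N + i) = P i)
    (q d : ℕ) (hd : 1 ≤ d) (hqd : ∀ i, P (i + (d + q)) = T i)
    (Q : ℕ → Bool) (hQ1 : ∀ i < d, Q i = P (i + q)) (hQ2 : ∀ i, Q (d + i) = P i)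
    (hx : seqLe T (fun i => P (i + q))) : seqLe B Q := by
  have hTper : ∀ i, T (i + N) = T i := fun i => by
    rw [hT, hT, show i + N + ℓ = i + ℓ + N by ring, hper]
  have BN : B N = false := by have := hB2 0; simpa [P0] using this
  have TN : T N = true := by have := hTper 0; simpa [T0] using this
  rcases Nat.lt_or_ge d N with hdN | hdN
  ·
    by_cases hag : ∀ i < d, T i = P (i + q)
    · have h1 : seqLe (fun i => T (i + d)) T := by
        rcases hx with ⟨p, hp, hp'⟩ | hx
        · have hpd : d ≤ p := by
            by_contra hc
            rw [hag p (by omega)] at hp'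
            exact lt_irrefl _ hp'
          left
          refine ⟨p - d, fun i hi => ?_, ?_⟩
          · have := hp (i + d) (by omega)
            simp only at this ⊢
            rw [this, ← hqd i]; congr 1; ring
          · have h2 := hqd (p - d)
            rw [show p - d + (d + q) = p + q by omega] at h2
            simp only [Nat.sub_add_cancel hpd]
            rw [← h2]; exact hp'
        · right
          funext i
          have := congrFun hx (i + d)
          rw [this, ← hqd i]; congr 1; ring
      have h2 : seqLe (fun i => T (i + d)) P := by
        rcases seqLt_or_le P (fun i => T (i + d)) with h | h
        · exact absurd ⟨h, h1⟩ (E2 d hd (by omega))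
        · exact h
      have h3 : seqLe T Q := by
        rcases h2 with ⟨p, hp, hp'⟩ | h2
        · left
          refine ⟨d + p, fun i hi => ?_, ?_⟩
          · rcases Nat.lt_or_ge i d with h | h
            · rw [hQ1 i h, hag i h]
            · obtain ⟨r, rfl⟩ := Nat.exists_eq_add_of_le h
              rw [hQ2, ← hp r (by omega), add_comm]
          · rw [hQ2, add_comm]; exact hp'
        · right
          funext i
          rcases Nat.lt_or_ge i d with h | h
          · rw [hQ1 i h, hag i h]
          · obtain ⟨r, rfl⟩ := Nat.exists_eq_add_of_le h
            rw [hQ2, ← congrFun h2 r, add_comm]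
      left
      refine seqLt_of_lt_of_le ⟨N, hB1, ?_⟩ h3
      rw [BN, TN]; decide
    · push Not at hag
      obtain ⟨i, hi, hne⟩ := hag
      rcases hx with ⟨p, hp, hp'⟩ | hx
      · have hpd : p < d := by
          by_contra hc
          exact hne (hp i (by omega))
        left
        refine ⟨p, fun j hj => ?_, ?_⟩
        · rw [hB1 j (by omega), hQ1 j (by omega)]; exact hp j hj
        · rw [hB1 p (by omega), hQ1 p (by omega)]; exact hp'
      · exact absurd (congrFun hx i) hne
  · rcases hx with ⟨p, hp, hp'⟩ | hx
    · have hpN : p < N := by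
        by_contra hc
        have h := hp (p - N) (by omega)
        have h1 := hTper (p - N)
        have h2 := hper (p - N + q)
        rw [Nat.sub_add_cancel (by omega)] at h1
        rw [show p - N + q + N = p + q by omega] at h2
        simp only at h hp'
        rw [h1, h2, h] at hp'
        exact lt_irrefl _ hp'
      left
      refine ⟨p, fun j hj => ?_, ?_⟩
      · rw [hB1 j (by omega), hQ1 j (by omega)]; exact hp j hj
      · rw [hB1 p (by omega), hQ1 p (by omega)]; exact hp'
    · rcases hdN.lt_or_eq with h | h
      · left
        refine ⟨N, fun i hi => ?_, ?_⟩
        · rw [hB1 i hi, hQ1 i (by omega)]; exact congrFun hx i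
        · rw [hQ1 N h, BN, ← congrFun hx N, TN]; decide
      · subst h
        right
        funext i
        rcases Nat.lt_or_ge i N with h | h
        · rw [hB1 i h, hQ1 i h]; exact congrFun hx i
        · obtain ⟨r, rfl⟩ := Nat.exists_eq_add_of_le h
          rw [hB2, hQ2]

lemma catInfPrefix_mono (f : ℕ → List Bool) (m k : ℕ) :
    catInfPrefix f m <+: catInfPrefix f (m + k) := by
  induction k with
  | zero => exact List.prefix_refl _
  | succ k ih => exact ih.trans (List.prefix_append _ _)

lemma catInfPrefix_len (f : ℕ → List Bool) (hf : ∀ i, 1 ≤ (f i).length) (m : ℕ) :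
    m ≤ (catInfPrefix f m).length := by
  induction m with
  | zero => simp
  | succ m ih =>
    have := hf m
    simp only [catInfPrefix, List.length_append]; omega

lemma prefix_getD {a b : List Bool} (h : a <+: b) (i : ℕ) (hi : i < a.length) :
    b.getD i false = a.getD i false := by
  obtain ⟨c, rfl⟩ := h
  exact List.getD_append _ _ _ _ hi

lemma catInf_apply (f : ℕ → List Bool) (hf : ∀ i, 1 ≤ (f i).length) (i r : ℕ)
    (hr : r < (f i).length) :
    catInf f ((catInfPrefix f i).length + r) = (f i).getD r false := by
  have h0 := catInfPrefix_len f hf i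
  unfold catInf
  have h := catInfPrefix_mono f (i + 1) ((catInfPrefix f i).length + r - i)
  rw [show i + 1 + ((catInfPrefix f i).length + r - i)
    = (catInfPrefix f i).length + r + 1 by omega] at h
  rw [prefix_getD h _ (by simp only [catInfPrefix, List.length_append]; omega)]
  simp only [catInfPrefix]
  rw [List.getD_append_right _ _ _ _ (by omega)]
  congr 1; omega

lemma catInf_pos (f : ℕ → List Bool) (hf : ∀ i, 1 ≤ (f i).length) (j : ℕ) :
    ∃ i q, q < (f i).length ∧ j = (catInfPrefix f i).length + q := by
  induction j with
  | zero => exact ⟨0, 0, hf 0, rfl⟩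
  | succ j ih =>
    obtain ⟨i, q, hq, rfl⟩ := ih
    by_cases h : q + 1 < (f i).length
    · exact ⟨i, q + 1, h, by ring⟩
    · refine ⟨i + 1, 0, hf _, ?_⟩
      simp only [catInfPrefix, List.length_append]; omega

lemma rep_length (s : List Bool) (m : ℕ) :
    ((List.replicate m s).flatten).length = m * s.length := by
  simp

lemma block_getD (s : List Bool) (ℓ : ℕ) (hℓ : ℓ < s.length) (m r : ℕ)
    (hr : r < m * s.length + ℓ) :
    ((List.replicate m s).flatten ++ s.take ℓ).getD r false = per s r := by
  induction m generalizing r with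
  | zero =>
    have hr' : r < ℓ := by simpa using hr
    unfold per
    rw [Nat.mod_eq_of_lt (by omega)]
    simp [List.getD, List.getElem?_take, hr']
  | succ m ih =>
    rw [List.replicate_succ, List.flatten_cons, List.append_assoc]
    rcases Nat.lt_or_ge r s.length with h | h
    · rw [List.getD_append _ _ _ _ h]
      unfold per
      rw [Nat.mod_eq_of_lt h]
    · rw [List.getD_append_right _ _ _ _ h, ih _ (by rw [Nat.succ_mul] at hr; omega)]
      unfold per
      rw [Nat.mod_eq_sub_mod h]

lemma per_rot (s : List Bool) (ℓ : ℕ) (hℓ : ℓ < s.length) (i : ℕ) :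
    per (s.drop ℓ ++ s.take ℓ) i = per s (i + ℓ) := by
  unfold per
  have hl : (s.drop ℓ ++ s.take ℓ).length = s.length := by simp; omega
  rw [hl, ← Nat.mod_add_mod]
  have hi : i % s.length < s.length := Nat.mod_lt _ (by omega)
  generalize i % s.length = r at hi
  rcases Nat.lt_or_ge r (s.length - ℓ) with h | h
  · rw [List.getD_append _ _ _ _ (by simpa using h), Nat.mod_eq_of_lt (by omega)]
    simp [List.getD, List.getElem?_drop, add_comm]
  · rw [List.getD_append_right _ _ _ _ (by simpa using h), Nat.mod_eq_sub_mod (by omega),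
      Nat.mod_eq_of_lt (by omega)]
    have h2 : r - (s.length - ℓ) < ℓ := by omega
    simp only [List.getD, List.getElem?_take, List.length_drop, h2, if_true]
    congr 2; omega

lemma isOpen_coord (a : ℕ → Bool) (n : ℕ) (b : Bool → Prop) :
    IsOpen {v : ℕ → Bool | (∀ i < n, v i = a i) ∧ b (v n)} := by
  apply IsOpen.and
  · have : {v : ℕ → Bool | ∀ i < n, v i = a i} = ⋂ i ∈ Set.Iio n, {v | v i = a i} := by
      ext v; simp
    rw [this]
    refine (Set.finite_Iio n).isOpen_biInter fun i _ => ?_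
    exact (isOpen_discrete ({a i} : Set Bool)).preimage (continuous_apply (A := fun _ : ℕ => Bool) i)
  · exact (isOpen_discrete {c | b c}).preimage (continuous_apply (A := fun _ : ℕ => Bool) n)

lemma isOpen_seqGt (a : ℕ → Bool) : IsOpen {v | seqLt a v} := by
  have : {v | seqLt a v} = ⋃ n, {v : ℕ → Bool | (∀ i < n, v i = a i) ∧ a n < v n} := by
    ext v; simp [seqLt, eq_comm]
  rw [this]
  exact isOpen_iUnion fun n => isOpen_coord a n (fun c => a n < c)

lemma isOpen_seqLt (a : ℕ → Bool) : IsOpen {v | seqLt v a} := by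
  have : {v | seqLt v a} = ⋃ n, {v : ℕ → Bool | (∀ i < n, v i = a i) ∧ v n < a n} := by
    ext v; simp [seqLt]
  rw [this]
  exact isOpen_iUnion fun n => isOpen_coord a n (fun c => c < a n)

theorem stmt7 (s : List Bool) (N : ℕ) (hN : s.length = N)
    (ℓ : ℕ) (hℓ1 : 1 ≤ ℓ) (hℓN : ℓ ≤ N - 1)
    (t : List Bool) (ht : t = s.drop ℓ ++ s.take ℓ)
    (hext : Extremal s t)
    (u : ℕ → Bool) (hu1 : seqLt (cat s (per t)) u) (hu2 : seqLt u (cat t (per s))) :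
    ∃ n : ℕ, 1 ≤ n ∧
      closure {v : ℕ → Bool | ∃ (j : ℕ) (ns : ℕ → ℕ), (∀ i, ns i = n ∨ ns i = n + 1) ∧
          v = shft^[j] (catInf (fun i => (List.replicate (ns i) s).flatten ++ s.take ℓ))}
        ∩ {v | seqLt (per s) v ∧ seqLt v u} = ∅ := by
  subst hN
  have hℓ : ℓ < s.length := by omega
  have htl : t.length = s.length := by rw [ht]; simp; omega
  obtain ⟨hs0, ht0, E1, E2⟩ := hext
  obtain ⟨p, hp, hp'⟩ := hu2
  have hT : ∀ i, per t i = per s (i + ℓ) := fun i => by rw [ht]; exact per_rot s ℓ hℓ i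
  have hper : ∀ i, per s (i + s.length) = per s i := fun i => by simp [per]
  have hperm : ∀ m i, per s (i + m * s.length) = per s i := fun m i => by simp [per]
  have P0 : per s 0 = false := by
    cases s <;> simp_all [per]
  have T0 : per t 0 = true := by
    cases t with
    | nil => simp at ht0
    | cons a l => simpa [per] using ht0
  refine ⟨p + 1, by omega, ?_⟩
  rw [Set.eq_empty_iff_forall_notMem]
  rintro v₀ ⟨hv, hv1, hv2⟩
  have hO : IsOpen {v | seqLt (per s) v ∧ seqLt v u} := (isOpen_seqGt _).and (isOpen_seqLt _)
  obtain ⟨v, ⟨hv1, hv2⟩, j, ns, hns, rfl⟩ := mem_closure_iff.1 hv _ hO ⟨hv1, hv2⟩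
  set f : ℕ → List Bool := fun i => (List.replicate (ns i) s).flatten ++ s.take ℓ with hf
  have hlen : ∀ i, (f i).length = ns i * s.length + ℓ := fun i => by
    simp only [hf, List.length_append, rep_length, List.length_take]; omega
  have hf1 : ∀ i, 1 ≤ (f i).length := fun i => by rw [hlen]; omega
  have hfP : ∀ i r, r < ns i * s.length + ℓ → (f i).getD r false = per s r := fun i r hr =>
    block_getD s ℓ hℓ _ _ hr
  obtain ⟨i, q, hq, rfl⟩ := catInf_pos f hf1 j
  set v := shft^[(catInfPrefix f i).length + q] (catInf f) with hvdef
  rw [hlen] at hq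
  obtain ⟨d, hd⟩ : ∃ d, ns i * s.length + ℓ = d + q := ⟨ns i * s.length + ℓ - q, by omega⟩
  have hv3 : ∀ r < d, v r = per s (r + q) := fun r hr => by
    rw [hvdef, shft_iter, ← hfP i (r + q) (by omega),
      ← catInf_apply f hf1 i (r + q) (by rw [hlen]; omega)]
    congr 1; ring
  have hbig : p + 1 ≤ ns (i + 1) * s.length := by
    have h1 : p + 1 ≤ ns (i + 1) := by rcases hns (i + 1) with h | h <;> omega
    have h2 : 1 ≤ s.length := by omega
    calc p + 1 ≤ ns (i + 1) := h1
      _ = ns (i + 1) * 1 := (mul_one _).symm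
      _ ≤ _ := Nat.mul_le_mul_left _ h2
  have hv4 : ∀ r ≤ p, v (d + r) = per s r := fun r hr => by
    rw [hvdef, shft_iter, ← hfP (i + 1) r (by omega),
      ← catInf_apply f hf1 (i + 1) r (by rw [hlen]; omega)]
    congr 1
    simp only [catInfPrefix, List.length_append, hlen]; omega
  have hqd : ∀ r, per s (r + (d + q)) = per t r := fun r => by
    rw [← hd, hT, show r + (ns i * s.length + ℓ) = r + ℓ + ns i * s.length by ring, hperm]
  -- dichotomy for the periodic point
  have hdich : seqLe (fun r => per s (r + q)) (per s) ∨
      seqLe (per t) (fun r => per s (r + q)) := by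
    have hmod : (fun r => per s (r + q)) = fun r => per s (r + q % s.length) := by
      funext r; simp [per]
    rw [hmod]
    have hlt : q % s.length < s.length := Nat.mod_lt _ (by omega)
    generalize q % s.length = k at hlt
    rcases Nat.eq_zero_or_pos k with rfl | hk
    · left; right; rfl
    · have h := E1 k hk (by omega)
      have e : shft^[k] (per s) = fun r => per s (r + k) := funext fun r => shft_iter _ _ _
      rw [e] at h
      rcases seqLt_or_le (fun r => per s (r + k)) (per s) with h1 | h1
      · left; left; exact h1
      · right
        rcases seqLt_or_le (fun r => per s (r + k)) (per t) with h2 | h2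
        · exact absurd ⟨h1, h2⟩ h
        · exact h2
  rcases hdich with hx | hx
  · have h1 : seqLt v (fun r => per s (r + q)) := by
      refine ⟨d, hv3, ?_⟩
      have h2 := hv4 0 (by omega)
      have h3 := hqd 0
      simp only [zero_add, add_zero] at h2 h3
      simp only [h2, h3, P0, T0]; decide
    exact seqLt_irrefl _ (seqLt_trans hv1 (seqLt_of_lt_of_le h1 hx))
  · have hc := core (per s) (per t) s.length ℓ (by omega) hper hT P0 T0
      (fun l h1 h2 => by
        have h := E2 l h1 (by omega)
        have e : shft^[l] (per t) = fun r => per t (r + l) := funext fun r => shft_iter _ _ _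
        rwa [e] at h)
      (cat t (per s))
      (fun i hi => by
        unfold cat
        rw [if_pos (by omega)]
        unfold per
        rw [Nat.mod_eq_of_lt (by omega)])
      (fun i => by
        unfold cat
        rw [if_neg (by omega)]
        congr 1; omega)
      q d (by omega) hqd
      (fun r => if r < d then per s (r + q) else per s (r - d))
      (fun i hi => by simp [hi]) (fun i => by simp) hx
    have : seqLt u v := seqLt_agree hp hp' hc (fun r hr => by
      by_cases h : r < d
      · simp only [h, if_true]; exact hv3 r h
      · simp only [h, if_false]
        rw [← hv4 (r - d) (by omega)]; congr 1; omega)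
    exact seqLt_irrefl _ (seqLt_trans this hv2)

end
end

section
/- For every n ≥ 2 and all rationals r_1,…,r_n ∈ (0,1): Δ(r_1,…,r_n) ⊆ Δ̃(r_1,…,r_{n−1}); moreover, for every n ≥ 1, if (r_1,…,r_n) and (r'_1,…,r'_n) are distinct n-tuples of rationals in (0,1), then Δ(r_1,…,r_n) ∩ Δ(r'_1,…,r'_n) = ∅. -/
noncomputable section

/-- Indicator of a bit. -/
def ind (b : Bool) : ℤ := if b then 1 else 0

/-- Number of ones among the first `n` letters. -/
def cnt (x : ℕ → Bool) (n : ℕ) : ℤ := ∑ i ∈ Finset.range n, ind (x i)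

lemma cnt_zero (x : ℕ → Bool) : cnt x 0 = 0 := by simp [cnt]

lemma cnt_succ (x : ℕ → Bool) (n : ℕ) : cnt x (n+1) = cnt x n + ind (x n) := by
  simp [cnt, Finset.sum_range_succ]

lemma cnt_congr {x y : ℕ → Bool} {n : ℕ} (h : ∀ i < n, x i = y i) : cnt x n = cnt y n := by
  unfold cnt
  apply Finset.sum_congr rfl
  intro i hi
  rw [h i (Finset.mem_range.1 hi)]

lemma cnt_add (x : ℕ → Bool) (j k : ℕ) :
    cnt x (j+k) = cnt x j + ∑ i ∈ Finset.range k, ind (x (j+i)) := by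
  simp [cnt, Finset.sum_range_add]

lemma ind_inj {a b : Bool} (h : ind a = ind b) : a = b := by
  cases a <;> cases b <;> simp_all [ind]

lemma seqLt_of_cnt {u v : ℕ → Bool} (h : ∀ n, cnt u n ≤ cnt v n) (h2 : ∃ n, cnt u n < cnt v n) :
    seqLt u v := by
  classical
  have hne : ∃ n, u n ≠ v n := by
    by_contra hc
    push Not at hc
    obtain ⟨n, hn⟩ := h2
    rw [cnt_congr (fun i _ => hc i)] at hn
    exact lt_irrefl _ hn
  refine ⟨Nat.find hne, fun i hi => ?_, ?_⟩
  · have := Nat.find_min hne hi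
    simpa using this
  · have h1 := Nat.find_spec hne
    have h3 := h (Nat.find hne + 1)
    have h4 : cnt u (Nat.find hne) = cnt v (Nat.find hne) := by
      apply cnt_congr
      intro i hi
      have := Nat.find_min hne hi
      simpa using this
    rw [cnt_succ, cnt_succ, h4] at h3
    revert h1 h3
    generalize u (Nat.find hne) = a
    generalize v (Nat.find hne) = b
    cases a <;> cases b <;> simp [ind]

/-- A list padded by zeros. -/
def pad (l : List Bool) : ℕ → Bool := fun n => l.getD n false

lemma count_take (l : List Bool) (k : ℕ) : ((l.take k).count true : ℤ) = cnt (pad l) k := by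
  induction k with
  | zero => simp [cnt]
  | succ k ih =>
    rw [cnt_succ, ← ih]
    by_cases hk : k < l.length
    · rw [List.take_succ_eq_append_getElem hk, List.count_append]
      simp only [pad, List.getD_eq_getElem?_getD, List.getElem?_eq_getElem hk, Option.getD_some]
      cases l[k] <;> simp [ind]
    · rw [List.take_of_length_le (by omega), List.take_of_length_le (by omega)]
      simp [pad, ind, List.getElem?_eq_none (not_lt.1 hk)]

lemma count_mid (s u t : List Bool) :
    (u.count true : ℤ) = cnt (pad (s ++ u ++ t)) (s.length + u.length)
      - cnt (pad (s ++ u ++ t)) s.length := by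
  rw [← count_take, ← count_take]
  have h1 : (s ++ u ++ t).take (s.length + u.length) = s ++ u := by
    apply List.take_left'
    simp
  have h2 : (s ++ u ++ t).take s.length = s := by
    rw [List.append_assoc]
    exact List.take_left' rfl
  rw [h1, h2, List.count_append]
  push_cast
  ring

lemma lex_of_count : ∀ (u v : List Bool), u.length = v.length →
    (∀ k, (u.take k).count true ≤ (v.take k).count true) → u = v ∨ List.Lex (· < ·) u v
  | [], [], _, _ => Or.inl rfl
  | [], _ :: _, h, _ => by simp at h
  | _ :: _, [], h, _ => by simp at h
  | a :: u, b :: v, h, hk => by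
    have h1 := hk 1
    by_cases hab : a = b
    · subst hab
      rcases lex_of_count u v (by simpa using h) (fun k => by
        have := hk (k+1)
        simpa [List.count_cons] using this) with h2 | h2
      · left; rw [h2]
      · right; exact List.Lex.cons h2
    · right
      apply List.Lex.rel
      revert h1 hab
      cases a <;> cases b <;> simp

lemma pad_append (w : List Bool) (n : ℕ) (hn : n < 2 * w.length) : pad (w ++ w) n = per w n := by
  unfold pad per
  by_cases h : n < w.length
  · rw [List.getD_append _ _ _ _ h, Nat.mod_eq_of_lt h]
  · rw [List.getD_append_right _ _ _ _ (by omega), Nat.mod_eq_sub_mod (by omega),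
      Nat.mod_eq_of_lt (by omega)]

lemma per_add (w : List Bool) (n : ℕ) : per w (n + w.length) = per w n := by
  simp [per]

lemma cycBalanced_iff (w : List Bool) : CycBalanced w ↔
    ∀ i j k, i + k ≤ 2 * w.length → j + k ≤ 2 * w.length →
      (cnt (per w) (i+k) - cnt (per w) i) - (cnt (per w) (j+k) - cnt (per w) j) ≤ 1 := by
  have hc : ∀ n, n ≤ 2 * w.length → cnt (pad (w++w)) n = cnt (per w) n := fun n hn =>
    cnt_congr (fun i hi => pad_append w i (by omega))
  constructor
  · intro h i j k hi hj
    have hf : ∀ i, i + k ≤ 2 * w.length → ∃ u, u <:+: (w ++ w) ∧ u.length = k ∧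
        (u.count true : ℤ) = cnt (per w) (i+k) - cnt (per w) i := by
      intro i hi
      have e : (w++w).take i ++ ((w++w).drop i).take k ++ ((w++w).drop i).drop k = w ++ w := by
        rw [List.append_assoc, List.take_append_drop, List.take_append_drop]
      have l1 : ((w++w).take i).length = i := by simp; omega
      have l2 : (((w++w).drop i).take k).length = k := by simp; omega
      refine ⟨((w++w).drop i).take k, ⟨_, _, e⟩, l2, ?_⟩
      have := count_mid ((w++w).take i) (((w++w).drop i).take k) (((w++w).drop i).drop k)
      rw [e, l1, l2, hc _ hi, hc _ (by omega)] at this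
      exact this
    obtain ⟨u, hu, lu, cu⟩ := hf i hi
    obtain ⟨v, hv, lv, cv⟩ := hf j hj
    have := h u v hu hv (by omega)
    rw [cu, cv] at this
    exact this
  · rintro h u v ⟨s, t, e⟩ ⟨s', t', e'⟩ hl
    have b1 : s.length + u.length ≤ 2 * w.length := by
      have := congrArg List.length e
      simp at this; omega
    have b2 : s'.length + v.length ≤ 2 * w.length := by
      have := congrArg List.length e'
      simp at this; omega
    rw [count_mid s u t, count_mid s' v t', e, e', hc _ b1, hc _ b2, hc _ (by omega),
      hc _ (by omega), ← hl]
    rw [← hl] at b2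
    exact h _ _ _ b1 b2

lemma cnt_per_length (w : List Bool) : cnt (per w) w.length = (w.count true : ℤ) := by
  have := count_take w w.length
  rw [List.take_length] at this
  rw [this]
  apply cnt_congr
  intro i hi
  simp [per, pad, Nat.mod_eq_of_lt hi]

lemma sum_shift (w : List Bool) (l : ℕ) :
    ∑ j ∈ Finset.range w.length, ind (per w (j + l)) = (w.count true : ℤ) := by
  induction l with
  | zero => rw [← cnt_per_length]; simp [cnt]
  | succ l ih =>
    rw [← ih]
    have h1 := Finset.sum_range_succ (fun j => ind (per w (j + l))) w.length
    have h2 := Finset.sum_range_succ' (fun j => ind (per w (j + l))) w.length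
    rw [h1] at h2
    have h3 : per w (w.length + l) = per w (0 + l) := by
      rw [add_comm, per_add]; simp
    rw [h3] at h2
    have h4 := add_right_cancel h2
    rw [h4]
    apply Finset.sum_congr rfl
    intro j _
    congr 2
    ring

lemma window_bound (w : List Bool) (h : CycBalanced w) (i k : ℕ) (hi : i < w.length)
    (hk : k ≤ w.length) :
    (w.length : ℤ) * (cnt (per w) (i+k) - cnt (per w) i) < k * (w.count true : ℤ) + w.length ∧
    k * (w.count true : ℤ) < (w.length : ℤ) * (cnt (per w) (i+k) - cnt (per w) i) + w.length := by
  rw [cycBalanced_iff] at h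
  set D : ℕ → ℤ := fun i => cnt (per w) (i+k) - cnt (per w) i with hD
  have hsum : ∑ j ∈ Finset.range w.length, D j = k * (w.count true : ℤ) := by
    simp only [hD, cnt_add, add_sub_cancel_left]
    rw [Finset.sum_comm]
    rw [Finset.sum_congr rfl (fun l _ => sum_shift w l)]
    simp
  have hb : ∀ a < w.length, ∀ b < w.length, D a ≤ D b + 1 := by
    intro a ha b hb
    have := h a b k (by omega) (by omega)
    simp only [hD]; omega
  constructor
  · calc (w.length : ℤ) * D i = ∑ j ∈ Finset.range w.length, D i := by simp
      _ < ∑ j ∈ Finset.range w.length, (D j + 1) := by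
        apply Finset.sum_lt_sum
        · intro j hj; exact hb i hi j (Finset.mem_range.1 hj)
        · exact ⟨i, Finset.mem_range.2 hi, by omega⟩
      _ = _ := by rw [Finset.sum_add_distrib, hsum]; simp
  · calc k * (w.count true : ℤ) = ∑ j ∈ Finset.range w.length, D j := hsum.symm
      _ < ∑ j ∈ Finset.range w.length, (D i + 1) := by
        apply Finset.sum_lt_sum
        · intro j hj; exact hb j (Finset.mem_range.1 hj) i hi
        · exact ⟨i, Finset.mem_range.2 hi, by omega⟩
      _ = _ := by
        rw [Finset.sum_const, Finset.card_range, nsmul_eq_mul]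
        simp only [hD]
        ring

/-- Bit sequence with counting function `F`. -/
def bitF (F : ℤ → ℤ) (n : ℕ) : Bool := decide (F n = F ((n:ℤ) - 1) + 1)

structure Good (F : ℤ → ℤ) (q p : ℕ) : Prop where
  qpos : 0 < q
  step : ∀ k, F k = F (k-1) ∨ F k = F (k-1) + 1
  peri : ∀ k, F (k + q) = F k + p
  bal : ∀ a b k : ℤ, (F (a+k) - F a) - (F (b+k) - F b) ≤ 1

/-- The first `q` bits as a word. -/
def mw (F : ℤ → ℤ) (q : ℕ) : List Bool := (List.range q).map (bitF F)

lemma mw_length (F : ℤ → ℤ) (q : ℕ) : (mw F q).length = q := by simp [mw]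

lemma mw_getD (F : ℤ → ℤ) (q n : ℕ) (h : n < q) : (mw F q).getD n false = bitF F n := by
  simp [mw, List.getElem?_range h]

lemma Good.ind_bit {F : ℤ → ℤ} {q p : ℕ} (h : Good F q p) (n : ℕ) :
    ind (bitF F n) = F n - F ((n:ℤ)-1) := by
  rcases h.step n with h1 | h1 <;> simp [ind, bitF, h1]

lemma Good.bit_add {F : ℤ → ℤ} {q p : ℕ} (h : Good F q p) (n : ℕ) :
    bitF F (n + q) = bitF F n := by
  have h1 := h.peri n
  have h2 := h.peri ((n:ℤ) - 1)
  have h3 : ((n + q : ℕ) : ℤ) - 1 = (n:ℤ) - 1 + q := by push_cast; ring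
  simp only [bitF, h3, h2]
  push_cast
  rw [h1]
  congr 1
  apply propext
  constructor <;> intro h <;> omega

lemma Good.bit_mod {F : ℤ → ℤ} {q p : ℕ} (h : Good F q p) (n : ℕ) :
    bitF F (n % q) = bitF F n := by
  have hp : Function.Periodic (bitF F) q := fun n => h.bit_add n
  exact hp.map_mod_nat n

lemma Good.per_mw {F : ℤ → ℤ} {q p : ℕ} (h : Good F q p) : per (mw F q) = bitF F := by
  funext n
  unfold per
  rw [mw_length, mw_getD _ _ _ (Nat.mod_lt _ h.qpos), h.bit_mod]

lemma Good.cnt_bit {F : ℤ → ℤ} {q p : ℕ} (h : Good F q p) (n : ℕ) :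
    cnt (bitF F) n = F ((n:ℤ) - 1) - F (-1) := by
  induction n with
  | zero => simp [cnt]
  | succ n ih =>
    rw [cnt_succ, ih, h.ind_bit]
    push_cast
    rw [add_sub_cancel_right]
    ring

lemma Good.cyc {F : ℤ → ℤ} {q p : ℕ} (h : Good F q p) : CycBalanced (mw F q) := by
  rw [cycBalanced_iff, h.per_mw]
  intro i j k _ _
  simp only [h.cnt_bit]
  have := h.bal ((i:ℤ)-1) ((j:ℤ)-1) k
  have e1 : ((i + k : ℕ):ℤ) - 1 = (i:ℤ) - 1 + k := by push_cast; ring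
  have e2 : ((j + k : ℕ):ℤ) - 1 = (j:ℤ) - 1 + k := by push_cast; ring
  rw [e1, e2]
  omega

lemma Good.count {F : ℤ → ℤ} {q p : ℕ} (h : Good F q p) : (mw F q).count true = p := by
  have h1 := cnt_per_length (mw F q)
  rw [h.per_mw, mw_length, h.cnt_bit] at h1
  have h2 := h.peri (-1)
  have e : (q:ℤ) - 1 = -1 + q := by ring
  rw [e, h2] at h1
  omega

lemma Good.head {F : ℤ → ℤ} {q p : ℕ} (h : Good F q p) : (mw F q).head? = some (bitF F 0) := by
  have h1 := h.qpos
  obtain ⟨m, rfl⟩ : ∃ m, q = m + 1 := ⟨q - 1, by omega⟩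
  simp [mw, List.range_succ_eq_map]

/-- Ceiling counting function. -/
def Fm (r : ℚ) (k : ℤ) : ℤ := ⌈(k:ℚ) * r⌉
/-- Floor counting function. -/
def Fp (r : ℚ) (k : ℤ) : ℤ := ⌊(k:ℚ) * r⌋

lemma num_eq (r : ℚ) (h0 : 0 < r) : (r.den : ℚ) * r = (r.num.toNat : ℚ) := by
  have h1 : (0:ℤ) ≤ r.num := (Rat.num_pos.2 h0).le
  have h2 : ((r.num.toNat : ℤ) : ℚ) = (r.num : ℚ) := by rw [Int.toNat_of_nonneg h1]
  rw [mul_comm, Rat.mul_den_eq_num, ← h2]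
  exact Int.cast_natCast _

lemma good_Fm (r : ℚ) (h0 : 0 < r) (h1 : r < 1) : Good (Fm r) r.den r.num.toNat where
  qpos := r.den_pos
  step := by
    intro k
    have a1 : Fm r (k-1) ≤ Fm r k := by
      apply Int.ceil_mono; push_cast; nlinarith
    have a2 : Fm r k ≤ Fm r (k-1) + 1 := by
      unfold Fm
      rw [Int.ceil_le]
      have := Int.le_ceil (((k-1:ℤ):ℚ) * r)
      push_cast at this ⊢
      nlinarith
    omega
  peri := by
    intro k
    unfold Fm
    push_cast
    rw [add_mul, num_eq r h0, Int.ceil_add_natCast]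
  bal := by
    intro a b k
    have A1 := Int.le_ceil ((a:ℚ) * r)
    have B1 := Int.ceil_lt_add_one ((b:ℚ) * r)
    have C1 := Int.ceil_lt_add_one (((a+k:ℤ):ℚ) * r)
    have D1 := Int.le_ceil (((b+k:ℤ):ℚ) * r)
    have : (((Fm r (a+k) - Fm r a) - (Fm r (b+k) - Fm r b) : ℤ) : ℚ) < 2 := by
      unfold Fm
      push_cast at *
      linarith
    have : ((Fm r (a+k) - Fm r a) - (Fm r (b+k) - Fm r b) : ℤ) < 2 := by exact_mod_cast this
    omega

lemma good_Fp (r : ℚ) (h0 : 0 < r) (h1 : r < 1) : Good (Fp r) r.den r.num.toNat where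
  qpos := r.den_pos
  step := by
    intro k
    have a1 : Fp r (k-1) ≤ Fp r k := by
      apply Int.floor_mono; push_cast; nlinarith
    have a2 : Fp r k - 1 ≤ Fp r (k-1) := by
      unfold Fp
      rw [Int.le_floor]
      have := Int.floor_le ((k:ℚ) * r)
      push_cast at this ⊢
      nlinarith
    omega
  peri := by
    intro k
    unfold Fp
    push_cast
    rw [add_mul, num_eq r h0, Int.floor_add_natCast]
  bal := by
    intro a b k
    have A1 := Int.lt_floor_add_one ((a:ℚ) * r)
    have B1 := Int.floor_le ((b:ℚ) * r)
    have C1 := Int.floor_le (((a+k:ℤ):ℚ) * r)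
    have D1 := Int.lt_floor_add_one (((b+k:ℤ):ℚ) * r)
    have : (((Fp r (a+k) - Fp r a) - (Fp r (b+k) - Fp r b) : ℤ) : ℚ) < 2 := by
      unfold Fp
      push_cast at *
      linarith
    have : ((Fp r (a+k) - Fp r a) - (Fp r (b+k) - Fp r b) : ℤ) < 2 := by exact_mod_cast this
    omega

lemma Fm_neg_one (r : ℚ) (h0 : 0 < r) (h1 : r < 1) : Fm r (-1) = 0 := by
  unfold Fm; rw [Int.ceil_eq_iff]; push_cast; constructor <;> linarith
lemma Fp_neg_one (r : ℚ) (h0 : 0 < r) (h1 : r < 1) : Fp r (-1) = -1 := by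
  unfold Fp; rw [Int.floor_eq_iff]; push_cast; constructor <;> linarith
lemma Fm_zero (r : ℚ) : Fm r 0 = 0 := by simp [Fm]
lemma Fp_zero (r : ℚ) : Fp r 0 = 0 := by simp [Fp]
lemma Fm_one (r : ℚ) (h0 : 0 < r) (h1 : r < 1) : Fm r 1 = 1 := by
  unfold Fm; rw [Int.ceil_eq_iff]; push_cast; constructor <;> linarith

lemma bitFm_zero (r : ℚ) (h0 : 0 < r) (h1 : r < 1) : bitF (Fm r) 0 = false := by
  simp [bitF, Fm_neg_one r h0 h1, Fm_zero]
lemma bitFp_zero (r : ℚ) (h0 : 0 < r) (h1 : r < 1) : bitF (Fp r) 0 = true := by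
  simp [bitF, Fp_neg_one r h0 h1, Fp_zero]
lemma bitFm_one (r : ℚ) (h0 : 0 < r) (h1 : r < 1) : bitF (Fm r) 1 = true := by
  simp [bitF, Fm_one r h0 h1, Fm_zero]

lemma two_le_den (r : ℚ) (h0 : 0 < r) (h1 : r < 1) : 2 ≤ r.den := by
  by_contra hc
  have h2 := r.den_pos
  have h3 : r.den = 1 := by omega
  have h4 := num_eq r h0
  rw [h3] at h4
  simp only [Nat.cast_one, one_mul] at h4
  rw [h4] at h0 h1
  have h5 : 0 < r.num.toNat := by exact_mod_cast h0
  have h6 : r.num.toNat < 1 := by exact_mod_cast h1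
  omega

lemma mem_head {w : List Bool} {b : Bool} (h : w.head? = some b) : per w 0 = b := by
  cases w with
  | nil => simp at h
  | cons a w => simpa [per] using h

lemma cnt_pad_per (w : List Bool) (k : ℕ) (h : k ≤ w.length) : cnt (pad w) k = cnt (per w) k := by
  apply cnt_congr
  intro i hi
  simp [per, pad, Nat.mod_eq_of_lt (lt_of_lt_of_le hi h)]

lemma omega_bounds (r : ℚ) (h0 : 0 < r) (h1 : r < 1) (b : Bool) (v : List Bool)
    (hv : v ∈ OmegaSet r b) (k : ℕ) (hk : k + 1 ≤ r.den) :
    cnt (per v) (k+1) - ind b ≤ Fm r k ∧ Fp r k ≤ cnt (per v) (k+1) - ind b := by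
  obtain ⟨hl, hc, hb, hh⟩ := hv
  have hw := window_bound v hb 1 k (by have := two_le_den r h0 h1; omega) (by omega)
  have hc1 : cnt (per v) 1 = ind b := by
    rw [cnt_succ, cnt_zero, mem_head hh]; simp
  rw [hc1, add_comm 1 k, hl, hc] at hw
  generalize cnt (per v) (k+1) - ind b = D at hw
  have hq : (0:ℚ) < r.den := by exact_mod_cast r.den_pos
  have hr := num_eq r h0
  obtain ⟨ha, hb⟩ := hw
  have ha' : (r.den:ℚ) * D < k * (r.num.toNat : ℚ) + r.den := by exact_mod_cast ha
  have hb' : k * (r.num.toNat : ℚ) < (r.den:ℚ) * D + r.den := by exact_mod_cast hb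
  rw [← hr] at ha' hb'
  have ha2 : (D:ℚ) < k * r + 1 := by
    by_contra hcon; push Not at hcon
    nlinarith
  have hb2 : k * r < (D:ℚ) + 1 := by
    by_contra hcon; push Not at hcon
    nlinarith
  constructor
  · have := Int.le_ceil ((k:ℚ) * r)
    have h3 : (D:ℚ) < (⌈(k:ℚ) * r⌉:ℤ) + 1 := by linarith
    have h4 : D < ⌈(k:ℚ) * r⌉ + 1 := by exact_mod_cast h3
    simp only [Fm, Int.cast_natCast]; omega
  · have := Int.floor_le ((k:ℚ) * r)
    have h3 : ((⌊(k:ℚ) * r⌋:ℤ) : ℚ) < D + 1 := by linarith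
    have h4 : ⌊(k:ℚ) * r⌋ < D + 1 := by exact_mod_cast h3
    simp only [Fp, Int.cast_natCast]; omega

lemma isOmegaMinus_mw (r : ℚ) (h0 : 0 < r) (h1 : r < 1) : IsOmegaMinus r (mw (Fm r) r.den) := by
  have g := good_Fm r h0 h1
  refine ⟨⟨mw_length _ _, g.count, g.cyc, by rw [g.head, bitFm_zero r h0 h1]⟩, ?_⟩
  intro v hv
  have hl := hv.1
  have key : ∀ k, k ≤ r.den → (v.take k).count true ≤ ((mw (Fm r) r.den).take k).count true := by
    intro k hk
    have : cnt (pad v) k ≤ cnt (pad (mw (Fm r) r.den)) k := by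
      rw [cnt_pad_per _ _ (by omega), cnt_pad_per _ _ (by rw [mw_length]; omega), g.per_mw]
      cases k with
      | zero => simp [cnt]
      | succ k =>
        have := (omega_bounds r h0 h1 _ v hv k hk).1
        rw [g.cnt_bit, Fm_neg_one r h0 h1]
        simpa [ind] using this
    rw [← count_take, ← count_take] at this
    exact_mod_cast this
  apply lex_of_count _ _ (by rw [hl, mw_length])
  intro k
  by_cases hk : k ≤ r.den
  · exact key k hk
  · have := key r.den le_rfl
    rw [List.take_of_length_le (by omega), List.take_of_length_le (by rw [mw_length])] at this
    rw [List.take_of_length_le (by omega), List.take_of_length_le (by rw [mw_length]; omega)]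
    exact this

lemma isOmegaPlus_mw (r : ℚ) (h0 : 0 < r) (h1 : r < 1) : IsOmegaPlus r (mw (Fp r) r.den) := by
  have g := good_Fp r h0 h1
  refine ⟨⟨mw_length _ _, g.count, g.cyc, by rw [g.head, bitFp_zero r h0 h1]⟩, ?_⟩
  intro v hv
  have hl := hv.1
  have key : ∀ k, k ≤ r.den → ((mw (Fp r) r.den).take k).count true ≤ (v.take k).count true := by
    intro k hk
    have : cnt (pad (mw (Fp r) r.den)) k ≤ cnt (pad v) k := by
      rw [cnt_pad_per v _ (by omega), cnt_pad_per _ _ (by rw [mw_length]; omega), g.per_mw]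
      cases k with
      | zero => simp [cnt]
      | succ k =>
        have := (omega_bounds r h0 h1 _ v hv k hk).2
        rw [g.cnt_bit, Fp_neg_one r h0 h1]
        simp [ind] at this ⊢
        omega
    rw [← count_take, ← count_take] at this
    exact_mod_cast this
  rw [eq_comm]
  apply lex_of_count _ _ (by rw [hl, mw_length])
  intro k
  by_cases hk : k ≤ r.den
  · exact key k hk
  · have := key r.den le_rfl
    rw [List.take_of_length_le (by rw [mw_length]), List.take_of_length_le (by omega)] at this
    rw [List.take_of_length_le (by rw [mw_length]; omega), List.take_of_length_le (by omega)]
    exact this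

lemma lex_asymm (u v : List Bool) (h : List.Lex (· < ·) u v) (h' : List.Lex (· < ·) v u) :
    False := by
  have a : u < v := h
  have b : v < u := h'
  exact lt_asymm a b

lemma omegaMinus_eq (r : ℚ) (h0 : 0 < r) (h1 : r < 1) : omegaMinus r = mw (Fm r) r.den := by
  have hm := isOmegaMinus_mw r h0 h1
  have hex : ∃ w, IsOmegaMinus r w := ⟨_, hm⟩
  have hs := hex.choose_spec
  unfold omegaMinus
  rw [dif_pos hex]
  rcases hm.2 _ hs.1 with h | h
  · exact h
  · rcases hs.2 _ hm.1 with h' | h'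
    · exact h'.symm
    · exact (lex_asymm _ _ h h').elim

lemma omegaPlus_eq (r : ℚ) (h0 : 0 < r) (h1 : r < 1) : omegaPlus r = mw (Fp r) r.den := by
  have hm := isOmegaPlus_mw r h0 h1
  have hex : ∃ w, IsOmegaPlus r w := ⟨_, hm⟩
  have hs := hex.choose_spec
  unfold omegaPlus
  rw [dif_pos hex]
  rcases hm.2 _ hs.1 with h | h
  · exact h
  · rcases hs.2 _ hm.1 with h' | h'
    · exact h'.symm
    · exact (lex_asymm _ _ h h').elim

lemma cat_lt (w : List Bool) (x : ℕ → Bool) (n : ℕ) (h : n < w.length) :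
    cat w x n = w.getD n false := by simp [cat, h]

lemma cat_ge (w : List Bool) (x : ℕ → Bool) (n : ℕ) (h : w.length ≤ n) :
    cat w x n = x (n - w.length) := by simp [cat, not_lt.2 h]

lemma cat_nil (x : ℕ → Bool) : cat [] x = x := by funext n; simp [cat]

lemma cat_append (u v : List Bool) (x : ℕ → Bool) : cat (u ++ v) x = cat u (cat v x) := by
  funext n
  by_cases h1 : n < u.length
  · rw [cat_lt _ _ _ (by simp; omega), cat_lt _ _ _ h1, List.getD_append _ _ _ _ h1]
  · by_cases h2 : n < u.length + v.length
    · rw [cat_lt _ _ _ (by simpa using h2), cat_ge _ _ _ (by omega), cat_lt _ _ _ (by omega),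
        List.getD_append_right _ _ _ _ (by omega)]
    · rw [cat_ge _ _ _ (by simp; omega), cat_ge _ _ _ (by omega), cat_ge _ _ _ (by omega)]
      congr 1
      simp; omega

lemma cat_per (w : List Bool) : cat w (per w) = per w := by
  funext n
  by_cases h : n < w.length
  · rw [cat_lt _ _ _ h]; simp [per, Nat.mod_eq_of_lt h]
  · rw [cat_ge _ _ _ (by omega)]
    have := per_add w (n - w.length)
    rw [Nat.sub_add_cancel (by omega)] at this
    exact this.symm

lemma eq_per (w : List Bool) (hw : 0 < w.length) (x : ℕ → Bool) (h : cat w x = x) :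
    x = per w := by
  funext n
  induction n using Nat.strong_induction_on with
  | _ n ih =>
    rw [← h, ← cat_per]
    by_cases hn : n < w.length
    · rw [cat_lt _ _ _ hn, cat_lt _ _ _ hn]
    · rw [cat_ge _ _ _ (by omega), cat_ge _ _ _ (by omega)]
      exact ih _ (by omega)

/-- Counting function of the image of a letter. -/
def FB (r : ℚ) (b : Bool) : ℤ → ℤ := if b then Fp r else Fm r

/-- The substitution on infinite sequences. -/
def subS (r : ℚ) (x : ℕ → Bool) : ℕ → Bool :=
  fun n => bitF (FB r (x (n / r.den))) (n % r.den)

/-- Valid rational. -/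
def Val (r : ℚ) : Prop := 0 < r ∧ r < 1

lemma substR_cons (r : ℚ) (h : Val r) (a : Bool) (w : List Bool) :
    substR r (a :: w) = mw (FB r a) r.den ++ substR r w := by
  simp only [substR, List.map_cons, List.flatten_cons, omegaPlus_eq r h.1 h.2,
    omegaMinus_eq r h.1 h.2, FB]
  cases a <;> simp

lemma subS_cat_one (r : ℚ) (a : Bool) (x : ℕ → Bool) :
    subS r (cat [a] x) = cat (mw (FB r a) r.den) (subS r x) := by
  have hq := r.den_pos
  funext n
  by_cases h : n < r.den
  · rw [cat_lt _ _ _ (by rwa [mw_length]), mw_getD _ _ _ h]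
    simp [subS, Nat.div_eq_of_lt h, Nat.mod_eq_of_lt h, cat]
  · rw [cat_ge _ _ _ (by rw [mw_length]; omega), mw_length]
    obtain ⟨m, rfl⟩ : ∃ m, n = m + r.den := ⟨n - r.den, by omega⟩
    simp [subS, Nat.add_div_right _ hq, cat]

lemma subS_cat (r : ℚ) (h : Val r) (w : List Bool) (x : ℕ → Bool) :
    subS r (cat w x) = cat (substR r w) (subS r x) := by
  induction w with
  | nil => simp [substR, cat_nil]
  | cons a w ih =>
    rw [substR_cons r h, cat_append, ← ih, ← subS_cat_one, ← cat_append]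
    rfl

lemma substR_length_pos (r : ℚ) (h : Val r) (w : List Bool) (hw : 0 < w.length) :
    0 < (substR r w).length := by
  cases w with
  | nil => simp at hw
  | cons a w =>
    rw [substR_cons r h, List.length_append, mw_length]
    have := r.den_pos
    omega

lemma subS_per (r : ℚ) (h : Val r) (w : List Bool) (hw : 0 < w.length) :
    subS r (per w) = per (substR r w) := by
  apply eq_per _ (substR_length_pos r h w hw)
  rw [← subS_cat r h, cat_per]

/-- Iterated substitution. -/
def SubL : List ℚ → (ℕ → Bool) → (ℕ → Bool)
  | [], x => x
  | r :: rs, x => subS r (SubL rs x)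

lemma sWord_pos (rs : List ℚ) (h : ∀ r ∈ rs, Val r) : 0 < (sWord rs).length := by
  induction rs with
  | nil => simp [sWord]
  | cons r rs ih =>
    exact substR_length_pos r (h r (by simp)) _ (ih (fun r hr => h r (by simp [hr])))

lemma tWord_pos (rs : List ℚ) (h : ∀ r ∈ rs, Val r) : 0 < (tWord rs).length := by
  induction rs with
  | nil => simp [tWord]
  | cons r rs ih =>
    exact substR_length_pos r (h r (by simp)) _ (ih (fun r hr => h r (by simp [hr])))

lemma SubL_per_s (rs : List ℚ) (h : ∀ r ∈ rs, Val r) :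
    SubL rs (per [false]) = per (sWord rs) := by
  induction rs with
  | nil => rfl
  | cons r rs ih =>
    have h' : ∀ r ∈ rs, Val r := fun r hr => h r (by simp [hr])
    rw [SubL, ih h', subS_per r (h r (by simp)) _ (sWord_pos rs h')]
    rfl

lemma SubL_per_t (rs : List ℚ) (h : ∀ r ∈ rs, Val r) :
    SubL rs (per [true]) = per (tWord rs) := by
  induction rs with
  | nil => rfl
  | cons r rs ih =>
    have h' : ∀ r ∈ rs, Val r := fun r hr => h r (by simp [hr])
    rw [SubL, ih h', subS_per r (h r (by simp)) _ (tWord_pos rs h')]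
    rfl

lemma SubL_cat_s (rs : List ℚ) (h : ∀ r ∈ rs, Val r) (x : ℕ → Bool) :
    SubL rs (cat [false] x) = cat (sWord rs) (SubL rs x) := by
  induction rs with
  | nil => rfl
  | cons r rs ih =>
    rw [SubL, ih (fun r hr => h r (by simp [hr])), subS_cat r (h r (by simp))]
    rfl

lemma SubL_cat_t (rs : List ℚ) (h : ∀ r ∈ rs, Val r) (x : ℕ → Bool) :
    SubL rs (cat [true] x) = cat (tWord rs) (SubL rs x) := by
  induction rs with
  | nil => rfl
  | cons r rs ih =>
    rw [SubL, ih (fun r hr => h r (by simp [hr])), subS_cat r (h r (by simp))]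
    rfl

lemma SubL_append (rs : List ℚ) (r : ℚ) (x : ℕ → Bool) :
    SubL (rs ++ [r]) x = SubL rs (subS r x) := by
  induction rs with
  | nil => rfl
  | cons a rs ih => simp [SubL, ih]

lemma subS_lt (r : ℚ) (h : Val r) {x y : ℕ → Bool} (hxy : seqLt x y) :
    seqLt (subS r x) (subS r y) := by
  obtain ⟨n, h1, h2⟩ := hxy
  have hq := r.den_pos
  refine ⟨n * r.den, ?_, ?_⟩
  · intro i hi
    have : i / r.den < n := (Nat.div_lt_iff_lt_mul hq).2 hi
    simp [subS, h1 _ this]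
  · have hx : x n = false ∧ y n = true := by
      revert h2; cases x n <;> cases y n <;> simp
    simp [subS, Nat.mul_div_cancel _ hq, hx.1, hx.2, FB, bitFm_zero r h.1 h.2,
      bitFp_zero r h.1 h.2]

lemma subS_le (r : ℚ) (h : Val r) {x y : ℕ → Bool} (hxy : seqLe x y) :
    seqLe (subS r x) (subS r y) := by
  rcases hxy with h1 | h1
  · exact Or.inl (subS_lt r h h1)
  · right; rw [h1]

lemma SubL_le (rs : List ℚ) (h : ∀ r ∈ rs, Val r) {x y : ℕ → Bool} (hxy : seqLe x y) :
    seqLe (SubL rs x) (SubL rs y) := by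
  induction rs with
  | nil => exact hxy
  | cons r rs ih => exact subS_le r (h r (by simp)) (ih (fun r hr => h r (by simp [hr])))

lemma seqLt_trans_s8 {x y z : ℕ → Bool} (h1 : seqLt x y) (h2 : seqLt y z) : seqLt x z := by
  obtain ⟨n, a, b⟩ := h1
  obtain ⟨m, c, d⟩ := h2
  rcases lt_trichotomy n m with h | h | h
  · exact ⟨n, fun i hi => (a i hi).trans (c i (hi.trans h)), by rw [← c n h]; exact b⟩
  · subst h
    exact ⟨n, fun i hi => (a i hi).trans (c i hi), b.trans d⟩
  · exact ⟨m, fun i hi => (a i (hi.trans h)).trans (c i hi), by rw [a m h]; exact d⟩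

lemma seqLt_of_le_of_lt {x y z : ℕ → Bool} (h1 : seqLe x y) (h2 : seqLt y z) : seqLt x z := by
  rcases h1 with h1 | rfl
  · exact seqLt_trans_s8 h1 h2
  · exact h2

lemma seqLt_of_lt_of_le_s8 {x y z : ℕ → Bool} (h1 : seqLt x y) (h2 : seqLe y z) : seqLt x z := by
  rcases h2 with h2 | rfl
  · exact seqLt_trans_s8 h1 h2
  · exact h1

lemma seqLe_of_not {x y : ℕ → Bool} (h : ∀ n, (∀ i < n, x i = y i) → x n ≤ y n) : seqLe x y := by
  classical
  by_cases hne : ∃ n, x n ≠ y n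
  · left
    have hag : ∀ i < Nat.find hne, x i = y i := fun i hi => by
      simpa using Nat.find_min hne hi
    exact ⟨Nat.find hne, hag, lt_of_le_of_ne (h _ hag) (Nat.find_spec hne)⟩
  · right
    push Not at hne
    exact funext hne

lemma zero_seqLe (x : ℕ → Bool) : seqLe (per [false]) x :=
  seqLe_of_not (fun n _ => by simp [per, Nat.mod_one])

lemma seqLe_01 (x : ℕ → Bool) (h : x 0 = false) : seqLe x (cat [false] (per [true])) := by
  apply seqLe_of_not
  intro n _
  cases n with
  | zero => simp [h]
  | succ n => rw [cat_ge _ _ _ (by simp)]; simp [per, Nat.mod_one, Bool.le_true]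

lemma seqLe_010 (x : ℕ → Bool) (h1 : x 1 = true) :
    seqLe (cat [false] (cat [true] (per [false]))) x := by
  apply seqLe_of_not
  intro n _
  match n with
  | 0 => simp [cat]
  | 1 => simp [h1, Bool.le_true]
  | n+2 => simp [cat, per, Nat.mod_one]

lemma core_lt (a b : ℚ) (ha : Val a) (hb : Val b) (hab : a < b) :
    seqLt (subS a (cat [false] (per [true]))) (subS b (per [false])) := by
  have ga := good_Fm a ha.1 ha.2
  have gp := good_Fp a ha.1 ha.2
  have gb := good_Fm b hb.1 hb.2
  have e1 : subS a (cat [false] (per [true])) = cat (mw (Fm a) a.den) (bitF (Fp a)) := by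
    rw [subS_cat_one, subS_per a ha _ (by simp), substR_cons a ha]
    simp [substR, FB, gp.per_mw]
  have e2 : subS b (per [false]) = bitF (Fm b) := by
    rw [subS_per b hb _ (by simp), substR_cons b hb]
    simp [substR, FB, gb.per_mw]
  rw [e1, e2]
  set u := cat (mw (Fm a) a.den) (bitF (Fp a)) with hu
  have hq := two_le_den a ha.1 ha.2
  have hu1 : ∀ n ≤ a.den, cnt u n = Fm a ((n:ℤ)-1) := by
    intro n hn
    have : cnt u n = cnt (bitF (Fm a)) n := by
      apply cnt_congr
      intro i hi
      rw [hu, cat_lt _ _ _ (by rw [mw_length]; omega), mw_getD _ _ _ (by omega)]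
    rw [this, ga.cnt_bit, Fm_neg_one a ha.1 ha.2, sub_zero]
  have hu2 : ∀ n, cnt u (a.den + n) ≤ 1 + Fp a (((a.den + n : ℕ):ℤ)-1) := by
    intro n
    induction n with
    | zero =>
      rw [add_zero, hu1 _ le_rfl]
      have := Int.ceil_le_floor_add_one (((((a.den:ℕ):ℤ)-1 : ℤ):ℚ) * a)
      unfold Fm Fp
      omega
    | succ n ih =>
      rw [← add_assoc, cnt_succ]
      have hb : u (a.den + n) = bitF (Fp a) (a.den + n) := by
        rw [hu, cat_ge _ _ _ (by rw [mw_length]; omega), mw_length, add_comm a.den n,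
          gp.bit_add, Nat.add_sub_cancel]
      rw [hb, gp.ind_bit]
      have e : ((a.den + n + 1 : ℕ):ℤ) - 1 = ((a.den + n : ℕ):ℤ) := by push_cast; ring
      rw [e]
      omega
  have hu3 : ∀ n, cnt u (n+1) ≤ 1 + Fp a n := by
    intro n
    by_cases hn : n + 1 ≤ a.den
    · rw [hu1 _ hn]
      have e : ((n + 1 : ℕ):ℤ) - 1 = (n:ℤ) := by push_cast; ring
      have := Int.ceil_le_floor_add_one (((n:ℤ):ℚ) * a)
      rw [e]
      unfold Fm Fp
      omega
    · have := hu2 (n + 1 - a.den)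
      rw [Nat.add_sub_cancel' (by omega)] at this
      have e : ((n + 1 : ℕ):ℤ) - 1 = (n:ℤ) := by push_cast; ring
      rwa [e] at this
  have hv : ∀ n, cnt (bitF (Fm b)) (n+1) = Fm b n := by
    intro n
    rw [gb.cnt_bit, Fm_neg_one b hb.1 hb.2]
    push_cast
    simp
  apply seqLt_of_cnt
  · intro n
    match n with
    | 0 => simp [cnt]
    | 1 =>
      rw [hu1 1 (by omega), hv 0]; simp [Fm_zero]
    | n+2 =>
      refine (hu3 (n+1)).trans ?_
      rw [hv]
      have h1 := Int.floor_le ((((n+1:ℕ):ℤ):ℚ) * a)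
      have h2 := Int.le_ceil ((((n+1:ℕ):ℤ):ℚ) * b)
      have h3 : (((n+1:ℕ):ℤ):ℚ) * a < (((n+1:ℕ):ℤ):ℚ) * b := by
        apply mul_lt_mul_of_pos_left hab
        push_cast; positivity
      have h4 : ((⌊(((n+1:ℕ):ℤ):ℚ) * a⌋ : ℤ) : ℚ) < (⌈(((n+1:ℕ):ℤ):ℚ) * b⌉ : ℤ) := by linarith
      have h5 := Int.cast_lt.1 h4
      unfold Fm Fp
      omega
  · obtain ⟨n, hn⟩ := exists_nat_gt (1 / (b - a))
    refine ⟨n+1, lt_of_le_of_lt (hu3 n) ?_⟩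
    rw [hv]
    have hpos : 0 < b - a := by linarith
    rw [div_lt_iff₀ hpos] at hn
    have h1 := Int.floor_le (((n:ℤ):ℚ) * a)
    have h2 := Int.le_ceil (((n:ℤ):ℚ) * b)
    have h4 : ((1 + ⌊((n:ℤ):ℚ) * a⌋ : ℤ) : ℚ) < (⌈((n:ℤ):ℚ) * b⌉ : ℤ) := by
      push_cast at *; linarith
    exact Int.cast_lt.1 h4

lemma SubL_zero_false (rs : List ℚ) (h : ∀ r ∈ rs, Val r) (x : ℕ → Bool) (hx : x 0 = false) :
    SubL rs x 0 = false := by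
  induction rs with
  | nil => exact hx
  | cons r rs ih =>
    have hr := h r (by simp)
    simp [SubL, subS, ih (fun r hr => h r (by simp [hr])), FB, bitFm_zero r hr.1 hr.2]

lemma subS_one (r : ℚ) (h : Val r) (x : ℕ → Bool) (hx : x 0 = false) : subS r x 1 = true := by
  have := two_le_den r h.1 h.2
  simp [subS, Nat.div_eq_of_lt (show 1 < r.den by omega),
    Nat.mod_eq_of_lt (show 1 < r.den by omega), hx, FB, bitFm_one r h.1 h.2]

lemma subS_inf (r : ℚ) (h : Val r) (x : ℕ → Bool) (N : ℕ) : ∃ n, N ≤ n ∧ subS r x n = true := by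
  have hq := two_le_den r h.1 h.2
  cases hx : x N with
  | true =>
    refine ⟨N * r.den, by nlinarith, ?_⟩
    simp [subS, Nat.mul_div_cancel _ r.den_pos, hx, FB, bitFp_zero r h.1 h.2]
  | false =>
    refine ⟨1 + N * r.den, by nlinarith, ?_⟩
    simp [subS, Nat.add_mul_div_right _ _ r.den_pos, Nat.div_eq_of_lt (show 1 < r.den by omega),
      Nat.mod_eq_of_lt (show 1 < r.den by omega), hx, FB, bitFm_one r h.1 h.2]

lemma sep : ∀ (rs rs' : List ℚ), rs.length = rs'.length → (∀ r ∈ rs, Val r) →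
    (∀ r ∈ rs', Val r) → rs ≠ rs' →
    seqLt (SubL rs (cat [false] (per [true]))) (SubL rs' (per [false])) ∨
    seqLt (SubL rs' (cat [false] (per [true]))) (SubL rs (per [false]))
  | [], [], _, _, _, h => (h rfl).elim
  | [], _ :: _, h, _, _, _ => by simp at h
  | _ :: _, [], h, _, _, _ => by simp at h
  | a :: as, b :: bs, hl, ha, hb, hne => by
    have ha1 := ha a (by simp)
    have hb1 := hb b (by simp)
    have ha2 : ∀ r ∈ as, Val r := fun r hr => ha r (by simp [hr])
    have hb2 : ∀ r ∈ bs, Val r := fun r hr => hb r (by simp [hr])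
    have h01 : cat [false] (per [true]) 0 = false := by simp [cat]
    rcases lt_trichotomy a b with h | h | h
    · left
      exact seqLt_of_le_of_lt (subS_le a ha1 (seqLe_01 _ (SubL_zero_false as ha2 _ h01)))
        (seqLt_of_lt_of_le_s8 (core_lt a b ha1 hb1 h) (subS_le b hb1 (zero_seqLe _)))
    · subst h
      rcases sep as bs (by simpa using hl) ha2 hb2 (fun e => hne (by rw [e])) with h | h
      · left; exact subS_lt a ha1 h
      · right; exact subS_lt a ha1 h
    · right
      exact seqLt_of_le_of_lt (subS_le b hb1 (seqLe_01 _ (SubL_zero_false bs hb2 _ h01)))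
        (seqLt_of_lt_of_le_s8 (core_lt b a hb1 ha1 h) (subS_le a ha1 (zero_seqLe _)))

lemma pi_summable (w : ℕ → Bool) :
    Summable (fun n : ℕ => (if w n then (1:ℝ) else 0) / 2 ^ (n+1)) := by
  have h : Summable (fun n : ℕ => (1/2:ℝ) ^ n) := summable_geometric_two
  refine Summable.of_nonneg_of_le (fun n => by positivity) (fun n => ?_) h
  rw [div_pow, one_pow, pow_succ]
  apply div_le_div₀ (by norm_num) (by split_ifs <;> norm_num) (by positivity)
  have : (0:ℝ) < 2^n := by positivity
  linarith

lemma pi_rec (w : ℕ → Bool) :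
    piMap w = (if w 0 then (1:ℝ) else 0) / 2 + piMap (shft w) / 2 := by
  unfold piMap
  rw [(pi_summable w).tsum_eq_zero_add, ← tsum_div_const]
  simp only [shft, zero_add, pow_one]
  congr 1
  apply tsum_congr
  intro n
  rw [div_div, ← pow_succ]
  rfl

lemma pi_nonneg' (w : ℕ → Bool) : 0 ≤ piMap w := tsum_nonneg (fun n => by positivity)

lemma pi_le_one (w : ℕ → Bool) : piMap w ≤ 1 := by
  have h : ∑' n : ℕ, (1/2:ℝ) * (1/2) ^ n = 1 := by
    rw [tsum_mul_left, tsum_geometric_two]; norm_num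
  rw [← h]
  apply (pi_summable w).tsum_le_tsum _ (summable_geometric_two.mul_left _)
  intro n
  rw [div_pow, one_pow, pow_succ]
  have : (0:ℝ) < 2^n := by positivity
  split_ifs
  · apply le_of_eq; field_simp
  · rw [zero_div]; positivity

lemma pi_pos (w : ℕ → Bool) (n : ℕ) (h : w n = true) : 0 < piMap w := by
  apply (pi_summable w).tsum_pos (fun n => by positivity) n
  simp [h]

lemma pi_lt (n : ℕ) : ∀ (u v : ℕ → Bool), (∀ i < n, u i = v i) → u n < v n →
    piMap u ≤ piMap v ∧ ((∀ N, ∃ n, N ≤ n ∧ v n = true) → piMap u < piMap v) := by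
  induction n with
  | zero =>
    intro u v _ h
    have hx : u 0 = false ∧ v 0 = true := by
      revert h; cases u 0 <;> cases v 0 <;> simp
    rw [pi_rec u, pi_rec v, hx.1, hx.2]
    have h1 := pi_le_one (shft u)
    have h2 := pi_nonneg' (shft v)
    constructor
    · simp; linarith
    · intro hv
      obtain ⟨m, hm, hvm⟩ := hv 1
      have h3 := pi_pos (shft v) (m-1) (by
        simp only [shft]; rw [Nat.sub_add_cancel hm]; exact hvm)
      simp; linarith
  | succ n ih =>
    intro u v h h'
    have := ih (shft u) (shft v) (fun i hi => h (i+1) (by omega)) h'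
    rw [pi_rec u, pi_rec v, h 0 (by omega)]
    constructor
    · linarith [this.1]
    · intro hv
      have h3 := this.2 (fun N => by
        obtain ⟨m, hm, hvm⟩ := hv (N+1)
        refine ⟨m-1, by omega, ?_⟩
        simp only [shft]; rw [Nat.sub_add_cancel (by omega)]; exact hvm)
      linarith

lemma pi_mono {u v : ℕ → Bool} (h : seqLe u v) : piMap u ≤ piMap v := by
  rcases h with ⟨n, h1, h2⟩ | rfl
  · exact (pi_lt n u v h1 h2).1
  · exact le_rfl

lemma deltaI_eq (rs : List ℚ) (h : ∀ r ∈ rs, Val r) : DeltaI rs =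
    Set.Icc (piMap (SubL rs (per [false]))) (piMap (SubL rs (cat [false] (per [true])))) := by
  rw [SubL_cat_s rs h, SubL_per_s rs h, SubL_per_t rs h]; rfl

lemma deltaTilde_eq (rs : List ℚ) (h : ∀ r ∈ rs, Val r) : DeltaTilde rs =
    Set.Icc (piMap (SubL rs (cat [false] (cat [true] (per [false])))))
      (piMap (SubL rs (cat [false] (per [true])))) := by
  rw [SubL_cat_s rs h, SubL_cat_t rs h, SubL_cat_s rs h, SubL_per_s rs h, SubL_per_t rs h]; rfl

lemma disj_of_lt (rs rs' : List ℚ) (h : ∀ r ∈ rs, Val r) (h' : ∀ r ∈ rs', Val r)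
    (hl : 1 ≤ rs'.length)
    (hlt : seqLt (SubL rs (cat [false] (per [true]))) (SubL rs' (per [false]))) :
    ∀ x, x ∈ DeltaI rs → x ∈ DeltaI rs' → False := by
  intro x hx hx'
  rw [deltaI_eq rs h] at hx
  rw [deltaI_eq rs' h'] at hx'
  obtain ⟨n, h1, h2⟩ := hlt
  have := (pi_lt n _ _ h1 h2).2 (by
    cases rs' with
    | nil => simp at hl
    | cons r rs' => exact subS_inf r (h' r (by simp)) _)
  linarith [hx.2, hx'.1]

theorem stmt8 :
    (∀ rs : List ℚ, 2 ≤ rs.length → (∀ r ∈ rs, 0 < r ∧ r < 1) →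
      DeltaI rs ⊆ DeltaTilde rs.dropLast) ∧
    (∀ rs rs' : List ℚ, 1 ≤ rs.length → rs.length = rs'.length →
      (∀ r ∈ rs, 0 < r ∧ r < 1) → (∀ r ∈ rs', 0 < r ∧ r < 1) → rs ≠ rs' →
      DeltaI rs ∩ DeltaI rs' = ∅) := by

  constructor
  · intro rs hl hv
    have hne : rs ≠ [] := by rintro rfl; simp at hl
    obtain ⟨r, hr⟩ : ∃ r, rs = rs.dropLast ++ [r] := ⟨_, (List.dropLast_append_getLast hne).symm⟩
    have hr1 : Val r := hv r (by rw [hr]; simp)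
    have hd : ∀ r ∈ rs.dropLast, Val r := fun r h => hv r (List.mem_of_mem_dropLast h)
    rw [deltaI_eq rs hv, deltaTilde_eq _ hd]
    have e : ∀ x, SubL rs x = SubL rs.dropLast (subS r x) := fun x => by
      conv_lhs => rw [hr]
      exact SubL_append _ _ _
    rw [e, e]
    have hz : ∀ x : ℕ → Bool, x 0 = false → subS r x 0 = false := fun x hx =>
      SubL_zero_false [r] (by simpa using hr1) x hx
    apply Set.Icc_subset_Icc
    · exact pi_mono (SubL_le _ hd (seqLe_010 _ (subS_one r hr1 _ (by simp [per]))))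
    · exact pi_mono (SubL_le _ hd (seqLe_01 _ (hz _ (by simp [cat]))))
  · intro rs rs' hl hl' hv hv' hne
    apply Set.eq_empty_of_forall_notMem
    rintro x ⟨hx, hx'⟩
    rcases sep rs rs' hl' hv hv' hne with h | h
    · exact disj_of_lt rs rs' hv hv' (by omega) h x hx hx'
    · exact disj_of_lt rs' rs hv' hv hl h x hx' hx

end
end
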